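/- Adam setup with Assumptions 1 and 2. Fix q with 1/2 < q < 1 and p > 1 − q, and choose η_k = 1/k^q and θ_k = 1 − 1/k^p. Then almost surely K^{1−q} · min_{1≤k≤K} ‖∇f(x^k)‖² → 0 as K → ∞, i.e. min_{1≤k≤K} ‖∇f(x^k)‖² = o(1/K^{1−q}) almost surely. -/

import Mathlib

open MeasureTheory Filter Finset Real

noncomputable section

/-- The sequence `(n + 1) ^ (-p)`. -/
def invPow (p : ℝ) (n : ℕ) : ℝ := ((n : ℝ) + 1) ^ (-p)

lemma invPow_pos (p : ℝ) (n : ℕ) : 0 < invPow p n := by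
  unfold invPow; positivity

lemma invPow_antitone {p : ℝ} (hp : 0 ≤ p) : Antitone (invPow p) := by
  intro m n hmn
  have h : (m : ℝ) ≤ n := by exact_mod_cast hmn
  exact rpow_le_rpow_of_nonpos (by positivity) (by linarith) (by linarith)

lemma invPow_le_one {p : ℝ} (hp : 0 ≤ p) (n : ℕ) : invPow p n ≤ 1 := by
  simpa [invPow] using invPow_antitone hp (Nat.zero_le n)

lemma invPow_mul (p q : ℝ) (n : ℕ) : invPow p n * invPow q n = invPow (p + q) n := by
  unfold invPow
  rw [← rpow_add (by positivity)]
  ring_nf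

lemma invPow_le_invPow {p q : ℝ} (h : p ≤ q) (n : ℕ) : invPow q n ≤ invPow p n := by
  unfold invPow
  exact rpow_le_rpow_of_exponent_le (by linarith [(Nat.cast_nonneg n : (0 : ℝ) ≤ n)]) (by linarith)

lemma summable_invPow {p : ℝ} (hp : 1 < p) : Summable (invPow p) := by
  have h := (summable_nat_add_iff 1).2 (Real.summable_nat_rpow.2 (by linarith : -p < -1))
  change Summable fun n : ℕ => ((n : ℝ) + 1) ^ (-p)
  simpa using h

lemma tendsto_invPow {p : ℝ} (hp : 0 < p) : Tendsto (invPow p) atTop (nhds 0) := by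
  have h := (tendsto_rpow_neg_atTop hp).comp
    (tendsto_atTop_add_const_right atTop (1 : ℝ) tendsto_natCast_atTop_atTop)
  change Tendsto (fun n : ℕ => ((n : ℝ) + 1) ^ (-p)) atTop (nhds 0)
  simpa [Function.comp_def] using h

lemma one_div_rpow_eq_invPow (p : ℝ) (n : ℕ) :
    1 / ((n + 1 : ℕ) : ℝ) ^ p = invPow p n := by
  unfold invPow
  rw [rpow_neg (by positivity), one_div]
  push_cast
  rfl

/-- A recursion contracting at rate `1 - c * a n` with forcing of order `a n ^ 2` is of order
`a n`, where `a n = (n + 1) ^ (-p)` with `p < 1`. -/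
lemma exists_le_mul_invPow {p B c C D₀ : ℝ} (hp0 : 0 < p) (hp1 : p < 1) (hc : 0 < c)
    (hB : 0 ≤ B) (hC : 0 ≤ C) (hD₀ : 0 ≤ D₀) {N : ℕ} :
    ∃ K, 0 ≤ K ∧ ∀ D : ℕ → ℝ, (∀ n, 0 ≤ D n) → D 0 ≤ D₀ →
      (∀ n, D (n + 1) ≤ B * D n + C) →
      (∀ n, N ≤ n → D (n + 1) ≤ (1 - c * invPow p n) * D n + C * invPow p n ^ 2) →
      ∀ n, D n ≤ K * invPow p n := by
  have h1 : ∀ᶠ n : ℕ in atTop, c * invPow p n < 1 := by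
    have := (tendsto_invPow hp0).const_mul c
    exact this.eventually_lt_const (by simp)
  have h2 : ∀ᶠ n : ℕ in atTop, invPow (1 - p) n < c / 2 :=
    (tendsto_invPow (by linarith)).eventually_lt_const (by positivity)
  obtain ⟨N', hN'⟩ := eventually_atTop.1 (h1.and h2)
  set N₁ := max N N'
  have hcoarse : ∀ n, ∃ K, 0 ≤ K ∧ ∀ D : ℕ → ℝ, D 0 ≤ D₀ →
      (∀ n, D (n + 1) ≤ B * D n + C) → ∀ k ≤ n, D k ≤ K := by
    intro n
    induction n with
    | zero => exact ⟨D₀, hD₀, fun D h0 _ k hk => by rw [Nat.le_zero.1 hk]; exact h0⟩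
    | succ n ih =>
      obtain ⟨K, hK, h⟩ := ih
      refine ⟨max K (B * K + C), le_max_of_le_left hK, fun D h0 hD k hk => ?_⟩
      rcases Nat.lt_or_ge k (n + 1) with hlt | hge
      · exact (h D h0 hD k (by omega)).trans (le_max_left _ _)
      · obtain rfl : k = n + 1 := by omega
        have := h D h0 hD n le_rfl
        exact (hD n).trans (le_max_of_le_right (by gcongr))
  obtain ⟨K₁, hK₁, hK₁D⟩ := hcoarse N₁
  set K := max (K₁ / invPow p N₁) (2 * C / c)
  have hK0 : 0 ≤ K := le_max_of_le_right (by positivity)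
  refine ⟨K, hK0, fun D _ h0 hD hDN n => ?_⟩
  have hbase : ∀ n ≤ N₁, D n ≤ K * invPow p n := by
    intro n hn
    calc D n ≤ K₁ := hK₁D D h0 hD n hn
      _ = K₁ / invPow p N₁ * invPow p N₁ := by field_simp [(invPow_pos p N₁).ne']
      _ ≤ K * invPow p n :=
        mul_le_mul (le_max_left _ _) (invPow_antitone hp0.le hn) (invPow_pos _ _).le hK0
  rcases le_total n N₁ with hn | hn
  · exact hbase n hn
  induction n, hn using Nat.le_induction with
  | base => exact hbase _ le_rfl
  | succ n hn ih =>
    obtain ⟨ha, hb⟩ := hN' n ((le_max_right _ _).trans hn)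
    have hpos := invPow_pos p n
    have hdec : invPow p n - invPow p (n + 1) ≤ c / 2 * invPow p n ^ 2 := by
      have hn0 : (0 : ℝ) ≤ n := Nat.cast_nonneg n
      have hr : invPow 1 n * invPow p n ≤ c / 2 * invPow p n ^ 2 := by
        have : invPow 1 n = invPow (1 - p) n * invPow p n := by rw [invPow_mul]; ring_nf
        rw [this]
        nlinarith [mul_le_mul_of_nonneg_right hb.le (sq_nonneg (invPow p n))]
      have hone : invPow 1 n = 1 / ((n : ℝ) + 1) := by
        unfold invPow; rw [rpow_neg_one, one_div]
      have hratio : (1 - 1 / ((n : ℝ) + 1)) * invPow p n ≤ invPow p (n + 1) := by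
        have hq : invPow p (n + 1) = (((n : ℝ) + 1) / ((n : ℝ) + 2)) ^ p * invPow p n := by
          unfold invPow
          rw [div_rpow (by positivity) (by positivity), rpow_neg (by positivity),
            rpow_neg (by positivity)]
          push_cast
          rw [show (n : ℝ) + 1 + 1 = n + 2 by ring]
          field_simp
        rw [hq]
        gcongr
        calc 1 - 1 / ((n : ℝ) + 1) ≤ ((n : ℝ) + 1) / ((n : ℝ) + 2) := by
              rw [one_sub_div (by positivity), div_le_div_iff₀ (by positivity) (by positivity)]
              nlinarith
          _ ≤ _ := by
            conv_lhs => rw [← rpow_one (((n : ℝ) + 1) / ((n : ℝ) + 2))]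
            refine rpow_le_rpow_of_exponent_ge (by positivity) ?_ hp1.le
            rw [div_le_one (by positivity)]; linarith
      rw [hone] at hr
      nlinarith
    have h := hDN n ((le_max_left _ _).trans hn)
    have hCK : 2 * C ≤ c * K := by
      have : 2 * C / c ≤ K := le_max_right _ _
      rw [div_le_iff₀ hc] at this; linarith
    have h3 : (1 - c * invPow p n) * D n ≤ (1 - c * invPow p n) * (K * invPow p n) :=
      mul_le_mul_of_nonneg_left ih (by linarith)
    have h4 := mul_le_mul_of_nonneg_left hdec hK0
    have h5 := mul_le_mul_of_nonneg_right hCK (sq_nonneg (invPow p n))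
    nlinarith

/-- Weighted summability of `B` from an approximate recursive lower bound on `A` and an upper
bound on the weighted partial sums of `A`. -/
lemma summable_of_momentum_descent {A B e η b : ℕ → ℝ} {β c C : ℝ} (hβ0 : 0 ≤ β) (hβ1 : β < 1)
    (hc : 0 < c) (hη : ∀ n, 0 < η n) (hηa : Antitone η) (hB : ∀ n, 0 ≤ B n) (he : ∀ n, 0 ≤ e n)
    (hb : ∀ n, 0 ≤ b n ∧ b n ≤ β)
    (hA : ∀ n, b n * A n + c * B (n + 1) - e n ≤ A (n + 1))
    (hηe : Summable fun n => η (n + 1) * e n)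
    (hsum : ∀ N, ∑ n ∈ range N, η n * A n ≤ C) :
    Summable fun n => η n * B n := by
  set s : ℕ → ℝ := fun n => max (-A n) 0 with hs
  have hs0 : ∀ n, 0 ≤ s n := fun n => le_max_right _ _
  have hsA : ∀ n, -s n ≤ A n := fun n => by
    have : -A n ≤ s n := le_max_left _ _
    linarith
  have hbs : ∀ n, -(β * s n) ≤ b n * A n := fun n => by
    have h1 := mul_le_mul_of_nonneg_left (hsA n) (hb n).1
    have h2 := mul_le_mul_of_nonneg_right (hb n).2 (hs0 n)
    linarith
  have hlow : ∀ n, c * B (n + 1) ≤ A (n + 1) + β * s n + e n := fun n => by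
    linarith [hA n, hbs n]
  have hrec : ∀ n, s (n + 1) ≤ β * s n + e n := fun n => by
    refine max_le ?_ ?_
    · have := mul_nonneg hc.le (hB (n + 1))
      linarith [hlow n]
    · have := mul_nonneg hβ0 (hs0 n)
      linarith [he n]
  set T := ∑' n, η (n + 1) * e n
  have hT : ∀ N, ∑ n ∈ range N, η (n + 1) * e n ≤ T := fun N =>
    hηe.sum_le_tsum _ (fun n _ => mul_nonneg (hη _).le (he n))
  have hηs : ∀ n, η (n + 1) * s n ≤ η n * s n := fun n =>
    mul_le_mul_of_nonneg_right (hηa (Nat.le_succ n)) (hs0 n)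
  have hS : ∀ N, ∑ n ∈ range N, η n * s n ≤ (η 0 * s 0 + T) / (1 - β) := by
    intro N
    have h1 : ∑ n ∈ range (N + 1), η n * s n
        ≤ η 0 * s 0 + β * ∑ n ∈ range N, η n * s n + T := by
      rw [sum_range_succ', mul_sum]
      have : ∑ n ∈ range N, η (n + 1) * s (n + 1)
          ≤ ∑ n ∈ range N, (β * (η n * s n) + η (n + 1) * e n) := by
        refine sum_le_sum fun n _ => ?_
        have h1 := mul_le_mul_of_nonneg_left (hrec n) (hη (n + 1)).le
        have h2 := mul_le_mul_of_nonneg_left (hηs n) hβ0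
        nlinarith
      rw [sum_add_distrib] at this
      linarith [hT N]
    rw [sum_range_succ] at h1
    have h2 := mul_nonneg (hη N).le (hs0 N)
    rw [le_div_iff₀ (by linarith)]
    nlinarith
  rw [← summable_nat_add_iff 1]
  refine summable_of_sum_range_le
    (c := (C - η 0 * A 0 + β * ((η 0 * s 0 + T) / (1 - β)) + T) / c)
    (fun n => mul_nonneg (hη _).le (hB _)) fun N => ?_
  rw [le_div_iff₀ hc, sum_mul]
  have h1 : ∑ n ∈ range N, η (n + 1) * B (n + 1) * c
      ≤ ∑ n ∈ range N, (η (n + 1) * A (n + 1) + β * (η n * s n) + η (n + 1) * e n) := by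
    refine sum_le_sum fun n _ => ?_
    have h1 := mul_le_mul_of_nonneg_left (hlow n) (hη (n + 1)).le
    have h2 := mul_le_mul_of_nonneg_left (hηs n) hβ0
    nlinarith
  rw [sum_add_distrib, sum_add_distrib, ← mul_sum] at h1
  have h2 := hsum (N + 1)
  rw [sum_range_succ'] at h2
  have h3 := mul_le_mul_of_nonneg_left (hS N) hβ0
  linarith [hT N]

/-- If `∑ (n + 1) ^ (-q) * y n` converges, then the running minimum of `y` is
`o((n + 1) ^ (q - 1))`. -/
lemma tendsto_rpow_mul_inf'_of_summable {q : ℝ} (hq : 0 ≤ q) {y : ℕ → ℝ} (hy : ∀ k, 0 ≤ y k)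
    (hsum : Summable fun n => invPow q n * y (n + 1)) :
    Tendsto (fun K : ℕ => ((K + 1 : ℕ) : ℝ) ^ (1 - q) *
        (Finset.Icc 1 (K + 1)).inf' (Finset.nonempty_Icc.mpr (by omega)) y)
      atTop (nhds 0) := by
  have hhalf : Tendsto (fun K : ℕ => (K + 1) / 2) atTop atTop := by
    refine tendsto_atTop.2 fun b => eventually_atTop.2 ⟨2 * b, fun n hn => ?_⟩
    omega
  have htail := ((tendsto_sum_nat_add fun n => invPow q n * y (n + 1)).comp hhalf).const_mul 2
  rw [mul_zero] at htail
  refine squeeze_zero (fun K => ?_) (fun K => ?_) htail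
  · exact mul_nonneg (by positivity) ((Finset.le_inf'_iff _ _).2 fun k _ => hy k)
  set I := (Finset.Icc 1 (K + 1)).inf' (Finset.nonempty_Icc.mpr (by omega)) y with hI
  have hI0 : 0 ≤ I := (Finset.le_inf'_iff _ _).2 fun k _ => hy k
  set J := (K + 1) / 2 with hJ
  have hs := (summable_nat_add_iff J).2 hsum
  have h1 : ∑ n ∈ range (K + 1 - J), invPow q (n + J) * y (n + J + 1)
      ≤ ∑' n, invPow q (n + J) * y (n + J + 1) :=
    hs.sum_le_tsum _ (fun n _ => mul_nonneg (invPow_pos _ _).le (hy _))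
  have h2 : ((K + 1 - J : ℕ) : ℝ) * (invPow q K * I)
      ≤ ∑ n ∈ range (K + 1 - J), invPow q (n + J) * y (n + J + 1) := by
    have := Finset.card_nsmul_le_sum (range (K + 1 - J))
      (fun n => invPow q (n + J) * y (n + J + 1)) (invPow q K * I) (fun n hn => by
        have hn := Finset.mem_range.1 hn
        refine mul_le_mul (invPow_antitone hq (by omega)) (Finset.inf'_le _ ?_) hI0
          (invPow_pos _ _).le
        exact Finset.mem_Icc.2 ⟨by omega, by omega⟩)
    simpa using this
  have h3 : ((K : ℝ) + 1) ≤ 2 * ((K + 1 - J : ℕ) : ℝ) := by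
    have : K + 1 ≤ 2 * (K + 1 - J) := by omega
    exact_mod_cast this
  have h4 : ((K + 1 : ℕ) : ℝ) ^ (1 - q) = ((K : ℝ) + 1) * invPow q K := by
    unfold invPow
    push_cast
    rw [sub_eq_add_neg, rpow_add (by positivity), rpow_one]
  have h5 : 0 ≤ invPow q K * I := mul_nonneg (invPow_pos _ _).le hI0
  rw [h4, mul_assoc]
  have h6 := mul_le_mul_of_nonneg_right h3 h5
  simp only [Function.comp_apply]
  linarith

/-- One coordinate of a path of the moment estimates of Adam with `1 - θ = (n + 1) ^ (-p)`. -/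
structure AdamPath (p M β : ℝ) (b g m v : ℕ → ℝ) : Prop where
  m_zero : m 0 = 0
  v_zero : v 0 = 0
  m_succ : ∀ n, m (n + 1) = b n * m n + (1 - b n) * g n
  v_succ : ∀ n, v (n + 1) = (1 - invPow p n) * v n + invPow p n * g n ^ 2
  b_mem : ∀ n, 0 ≤ b n ∧ b n ≤ β
  abs_g_le : ∀ n, |g n| ≤ M

namespace AdamPath

variable {p M β : ℝ} {b g m v : ℕ → ℝ}

lemma M_nonneg (h : AdamPath p M β b g m v) : 0 ≤ M := (abs_nonneg _).trans (h.abs_g_le 0)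

lemma sq_g_le (h : AdamPath p M β b g m v) (n : ℕ) : g n ^ 2 ≤ M ^ 2 :=
  sq_le_sq' (abs_le.1 (h.abs_g_le n)).1 (abs_le.1 (h.abs_g_le n)).2

lemma abs_m_le (h : AdamPath p M β b g m v) (hβ1 : β < 1) (n : ℕ) : |m n| ≤ M := by
  induction n with
  | zero => simpa [h.m_zero] using h.M_nonneg
  | succ n ih =>
    have hb := h.b_mem n
    rw [abs_le] at ih ⊢
    have hg := abs_le.1 (h.abs_g_le n)
    rw [h.m_succ]
    constructor <;> nlinarith

lemma v_mem (h : AdamPath p M β b g m v) (hp : 0 ≤ p) (n : ℕ) : 0 ≤ v n ∧ v n ≤ M ^ 2 := by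
  induction n with
  | zero => simp [h.v_zero, sq_nonneg]
  | succ n ih =>
    have ha := invPow_le_one hp n
    have ha0 := invPow_pos p n
    rw [h.v_succ]
    have hg := h.sq_g_le n
    have hg0 := sq_nonneg (g n)
    constructor
    · have := mul_nonneg (sub_nonneg.2 ha) ih.1
      positivity
    · nlinarith

variable {ε : ℝ}

lemma sqrt_mem (h : AdamPath p M β b g m v) (hp : 0 ≤ p) (n : ℕ) :
    √ε ≤ √(v n + ε) ∧ √(v n + ε) ≤ √(M ^ 2 + ε) :=
  ⟨Real.sqrt_le_sqrt (by linarith [(h.v_mem hp n).1]),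
    Real.sqrt_le_sqrt (by linarith [(h.v_mem hp n).2])⟩

lemma sq_sqrt_eq (h : AdamPath p M β b g m v) (hp : 0 ≤ p) (hε : 0 < ε) (n : ℕ) :
    √(v n + ε) ^ 2 = v n + ε := Real.sq_sqrt (by linarith [(h.v_mem hp n).1])

lemma abs_sqrt_sub_le (h : AdamPath p M β b g m v) (hp : 0 ≤ p) (hε : 0 < ε) (n : ℕ) :
    |√(v (n + 1) + ε) - √(v n + ε)| ≤ M ^ 2 / √ε * invPow p n := by
  have hs : 0 < √ε := Real.sqrt_pos.2 hε
  have h1 := (h.sqrt_mem (ε := ε) hp n).1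
  have h2 := (h.sqrt_mem (ε := ε) hp (n + 1)).1
  have h3 : (√(v (n + 1) + ε) - √(v n + ε)) * (√(v (n + 1) + ε) + √(v n + ε))
      = invPow p n * (g n ^ 2 - v n) := by
    have e1 := h.sq_sqrt_eq hp hε n
    have e2 := h.sq_sqrt_eq hp hε (n + 1)
    have := h.v_succ n
    linear_combination e2 - e1 + this
  have h4 : |√(v (n + 1) + ε) - √(v n + ε)| * (√(v (n + 1) + ε) + √(v n + ε))
      ≤ invPow p n * M ^ 2 := by
    rw [← abs_of_nonneg (by linarith : 0 ≤ √(v (n + 1) + ε) + √(v n + ε)), ← abs_mul, h3, abs_mul,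
      abs_of_pos (invPow_pos p n)]
    gcongr
    · exact (invPow_pos p n).le
    have hg := h.sq_g_le n
    have hg0 := sq_nonneg (g n)
    have hv := h.v_mem hp n
    rw [abs_le]
    constructor <;> linarith
  rw [div_mul_eq_mul_div, le_div_iff₀ hs]
  have := abs_nonneg (√(v (n + 1) + ε) - √(v n + ε))
  nlinarith

lemma abs_ratio_le (h : AdamPath p M β b g m v) (hp : 0 ≤ p) (hε : 0 < ε) (hβ1 : β < 1) (n : ℕ) :
    |m n / √(v n + ε)| ≤ M / √ε := by
  rw [abs_div, abs_of_nonneg (Real.sqrt_nonneg _)]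
  exact div_le_div₀ h.M_nonneg (h.abs_m_le hβ1 n) (Real.sqrt_pos.2 hε) (h.sqrt_mem hp n).1

/-- The update direction satisfies the momentum recursion up to a small error. -/
lemma abs_sqrt_mul_sub_le (h : AdamPath p M β b g m v) (hp : 0 ≤ p) (hε : 0 < ε) (hβ1 : β < 1)
    (n : ℕ) :
    |√(v n + ε) * (m (n + 1) / √(v (n + 1) + ε) - b n * (m n / √(v n + ε))) - (1 - b n) * g n|
      ≤ M / √ε * (M ^ 2 / √ε) * invPow p n := by
  have hs : 0 < √ε := Real.sqrt_pos.2 hε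
  have h1 := (h.sqrt_mem (ε := ε) hp n).1
  have h2 := (h.sqrt_mem (ε := ε) hp (n + 1)).1
  have e1 : m n / √(v n + ε) * √(v n + ε) = m n := div_mul_cancel₀ _ (by linarith)
  have e2 : m (n + 1) / √(v (n + 1) + ε) * √(v (n + 1) + ε) = m (n + 1) :=
    div_mul_cancel₀ _ (by linarith)
  have h3 : √(v n + ε) * (m (n + 1) / √(v (n + 1) + ε) - b n * (m n / √(v n + ε)))
      - (1 - b n) * g n
      = -(m (n + 1) / √(v (n + 1) + ε) * (√(v (n + 1) + ε) - √(v n + ε))) := by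
    linear_combination e2 - b n * e1 + h.m_succ n
  rw [h3, abs_neg, abs_mul, mul_assoc]
  exact mul_le_mul (h.abs_ratio_le hp hε hβ1 _) (h.abs_sqrt_sub_le hp hε n) (abs_nonneg _)
    (div_nonneg h.M_nonneg hs.le)

/-- The linearised recursion for the second moment estimate driven by the ratios
`m / √(v + ε)` only. -/
def linRec (p ε : ℝ) (b r : ℕ → ℝ) : ℕ → ℝ
  | 0 => ε
  | n + 1 => (1 - invPow p n + invPow p n * ((r (n + 1) - b n * r n) / (1 - b n)) ^ 2)
      * linRec p ε b r n + invPow p n * ε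

lemma exists_abs_linRec_sub_le (hp0 : 0 < p) (hp1 : p < 1) (hε : 0 < ε) (hM : 0 ≤ M)
    (hβ1 : β < 1) :
    ∃ K, 0 ≤ K ∧ ∀ b g m v : ℕ → ℝ, AdamPath p M β b g m v →
      ∀ n, |linRec p ε b (fun n => m n / √(v n + ε)) n - (v n + ε)| ≤ K * invPow p n := by
  have hs : 0 < √ε := Real.sqrt_pos.2 hε
  set C₀ := M / √ε * (M ^ 2 / √ε) / (1 - β) with hC₀
  have hC₀0 : 0 ≤ C₀ := div_nonneg (by positivity) (by linarith)
  set C := C₀ * (2 * M + C₀) with hC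
  have hC0 : 0 ≤ C := by positivity
  obtain ⟨N, hN⟩ := eventually_atTop.1
    (((tendsto_invPow hp0).const_mul C).eventually_lt_const
      (show C * 0 < ε / 2 by simpa using half_pos hε))
  obtain ⟨K, hK0, hK⟩ := exists_le_mul_invPow (p := p) (B := 1 + C / ε) (c := ε / (2 * (M ^ 2 + ε)))
    (C := C / ε) (D₀ := 0) hp0 hp1 (by positivity) (by positivity) (by positivity) le_rfl (N := N)
  refine ⟨K * (M ^ 2 + ε), by positivity, fun b g m v h n => ?_⟩
  set r : ℕ → ℝ := fun n => m n / √(v n + ε) with hr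
  set W := linRec p ε b r with hW
  set V : ℕ → ℝ := fun n => v n + ε with hV
  have hVε : ∀ n, ε ≤ V n := fun n => by simpa [hV] using (h.v_mem hp0.le n).1
  have hVM : ∀ n, V n ≤ M ^ 2 + ε := fun n => by simpa [hV] using (h.v_mem hp0.le n).2
  have hV0 : ∀ n, 0 < V n := fun n => hε.trans_le (hVε n)
  set k : ℕ → ℝ := fun n => (r (n + 1) - b n * r n) / (1 - b n) with hk
  set F : ℕ → ℝ := fun n => 1 - invPow p n + invPow p n * k n ^ 2 with hF
  have hF0 : ∀ n, 0 ≤ F n := fun n => by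
    have := invPow_le_one hp0.le n
    have := (invPow_pos p n).le
    have : 0 ≤ invPow p n * k n ^ 2 := by positivity
    simp only [hF]; linarith
  have hWsucc : ∀ n, W (n + 1) = F n * W n + invPow p n * ε := fun n => rfl
  have hgk : ∀ n, |k n * √(V n) - g n| ≤ C₀ * invPow p n := fun n => by
    have hb := h.b_mem n
    have hb' : 0 < 1 - b n := by linarith
    have h1 := h.abs_sqrt_mul_sub_le hp0.le hε hβ1 n
    have h2 : √(v n + ε) * (r (n + 1) - b n * r n) - (1 - b n) * g n
        = (1 - b n) * (k n * √(V n) - g n) := by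
      simp only [hk, hV]; field_simp
    simp only [hr] at h2
    rw [h2, abs_mul, abs_of_pos hb'] at h1
    have h3 : (1 - β) * |k n * √(V n) - g n| ≤ (1 - b n) * |k n * √(V n) - g n| := by
      gcongr; exact hb.2
    rw [show C₀ * invPow p n = M / √ε * (M ^ 2 / √ε) * invPow p n / (1 - β) by rw [hC₀]; ring,
      le_div_iff₀ (by linarith)]
    linarith
  have hforce : ∀ n, |k n ^ 2 * V n - g n ^ 2| ≤ C * invPow p n := fun n => by
    have e1 : k n ^ 2 * V n - g n ^ 2
        = (k n * √(V n) - g n) * ((k n * √(V n) - g n) + 2 * g n) := by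
      have := Real.sq_sqrt (hV0 n).le
      linear_combination (-(k n ^ 2)) * this
    have h2 : |(k n * √(V n) - g n) + 2 * g n| ≤ 2 * M + C₀ := by
      refine (abs_add_le _ _).trans ?_
      have h3 := hgk n
      have h4 := mul_le_mul_of_nonneg_left (invPow_le_one hp0.le n) hC₀0
      rw [abs_mul, abs_two]
      linarith [h.abs_g_le n]
    rw [e1, abs_mul, hC, mul_right_comm]
    exact mul_le_mul (hgk n) h2 (abs_nonneg _) (mul_nonneg hC₀0 (invPow_pos _ _).le)
  have hVsucc : ∀ n, V (n + 1)
      = F n * V n + invPow p n * ε - invPow p n * (k n ^ 2 * V n - g n ^ 2) := fun n => by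
    simp only [hV, hF, h.v_succ n]; ring
  have hdiff : ∀ n, |W (n + 1) - V (n + 1)| ≤ F n * |W n - V n| + C * invPow p n ^ 2 := fun n => by
    have e1 : W (n + 1) - V (n + 1)
        = F n * (W n - V n) + invPow p n * (k n ^ 2 * V n - g n ^ 2) := by
      rw [hWsucc, hVsucc]; ring
    rw [e1]
    refine (abs_add_le _ _).trans ?_
    rw [abs_mul, abs_mul, abs_of_nonneg (hF0 n), abs_of_pos (invPow_pos p n)]
    have := mul_le_mul_of_nonneg_left (hforce n) (invPow_pos p n).le
    linarith
  set D : ℕ → ℝ := fun n => |W n - V n| / V n with hD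
  have hD0 : ∀ n, 0 ≤ D n := fun n => div_nonneg (abs_nonneg _) (hV0 n).le
  have hDV : ∀ n, |W n - V n| = D n * V n := fun n => (div_mul_cancel₀ _ (hV0 n).ne').symm
  have hFV : ∀ n, F n * V n ≤ V (n + 1) - invPow p n * ε + C * invPow p n ^ 2 := fun n => by
    have := mul_le_mul_of_nonneg_left (abs_le.1 (hforce n)).2 (invPow_pos p n).le
    have := hVsucc n
    nlinarith
  have hDrec : ∀ n ρ, F n * V n ≤ ρ * V (n + 1) → D (n + 1) ≤ ρ * D n + C / ε * invPow p n ^ 2 :=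
    fun n ρ hρ => by
      have h1 : C * invPow p n ^ 2 ≤ C / ε * invPow p n ^ 2 * V (n + 1) := by
        calc C * invPow p n ^ 2 = C / ε * invPow p n ^ 2 * ε := by field_simp
          _ ≤ _ := by gcongr; exact hVε _
      have h2 := hdiff n
      rw [hDV n] at h2
      have h3 := mul_le_mul_of_nonneg_right hρ (hD0 n)
      simp only [hD]
      rw [div_le_iff₀ (hV0 _)]
      simp only [hD] at h2 h3
      nlinarith
  have hmain := hK D hD0 ?_ (fun n => ?_) (fun n hn => ?_) n
  · calc |W n - V n| = D n * V n := hDV n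
      _ ≤ K * invPow p n * (M ^ 2 + ε) :=
        mul_le_mul hmain (hVM n) (hV0 n).le (mul_nonneg hK0 (invPow_pos _ _).le)
      _ = _ := by ring
  · simp [hD, hW, hV, linRec, h.v_zero]
  · have ha1 := invPow_le_one hp0.le n
    have ha0 := invPow_pos p n
    have ha2 : invPow p n ^ 2 ≤ 1 := by nlinarith
    have hCε : 0 ≤ C / ε := by positivity
    refine (hDrec n (1 + C / ε) ?_).trans ?_
    · have h1 : C ≤ C / ε * V (n + 1) := by
        calc C = C / ε * ε := by field_simp
          _ ≤ _ := by gcongr; exact hVε _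
      nlinarith [hFV n, mul_pos ha0 hε, mul_le_mul_of_nonneg_left ha2 hC0]
    · nlinarith [mul_le_mul_of_nonneg_left ha2 hCε]
  · have ha0 := invPow_pos p n
    refine hDrec n _ ?_
    have h1 := hN n hn
    have h2 : ε / (2 * (M ^ 2 + ε)) * invPow p n * V (n + 1) ≤ ε / 2 * invPow p n := by
      calc ε / (2 * (M ^ 2 + ε)) * invPow p n * V (n + 1)
          ≤ ε / (2 * (M ^ 2 + ε)) * invPow p n * (M ^ 2 + ε) := by gcongr; exact hVM _
        _ = _ := by field_simp
    nlinarith [hFV n, mul_le_mul_of_nonneg_right h1.le ha0.le]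

end AdamPath

section Conditional

variable {Ω : Type*} {m₀ : MeasurableSpace Ω} {μ : Measure Ω} [IsProbabilityMeasure μ]

lemma integrable_of_ae_abs_le {X : Ω → ℝ} {C : ℝ} (hX : AEStronglyMeasurable X μ)
    (hC : ∀ᵐ ω ∂μ, |X ω| ≤ C) : Integrable X μ :=
  Integrable.of_bound hX C hC

lemma integral_sq_condExp_sub {m₁ m₂ : MeasurableSpace Ω} (h12 : m₁ ≤ m₂) (h2 : m₂ ≤ m₀)
    {X : Ω → ℝ} {C : ℝ} (hC : ∀ᵐ ω ∂μ, |X ω| ≤ C) :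
    ∫ ω, (μ[X|m₂] ω - μ[X|m₁] ω) ^ 2 ∂μ = ∫ ω, μ[X|m₂] ω ^ 2 ∂μ - ∫ ω, μ[X|m₁] ω ^ 2 ∂μ := by
  have hU : ∀ᵐ ω ∂μ, |μ[X|m₂] ω| ≤ C := ae_bdd_abs_condExp_of_ae_bdd_abs hC
  have hw : ∀ᵐ ω ∂μ, |μ[X|m₁] ω| ≤ C := ae_bdd_abs_condExp_of_ae_bdd_abs hC
  have hUm : AEStronglyMeasurable[m₀] (μ[X|m₂]) μ := integrable_condExp.aestronglyMeasurable
  have hwm : AEStronglyMeasurable[m₀] (μ[X|m₁]) μ := integrable_condExp.aestronglyMeasurable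
  have hprod : ∀ {Y Z : Ω → ℝ}, AEStronglyMeasurable[m₀] Y μ → AEStronglyMeasurable[m₀] Z μ →
      (∀ᵐ ω ∂μ, |Y ω| ≤ C) → (∀ᵐ ω ∂μ, |Z ω| ≤ C) → Integrable (Y * Z) μ :=
    fun hY hZ hYC hZC => integrable_of_ae_abs_le (C := C * C) (hY.mul hZ) (by
      filter_upwards [hYC, hZC] with ω h1 h2
      rw [Pi.mul_apply, abs_mul]
      exact mul_le_mul h1 h2 (abs_nonneg _) ((abs_nonneg _).trans h1))
  have hcross : ∫ ω, (μ[X|m₁] * μ[X|m₂]) ω ∂μ = ∫ ω, (μ[X|m₁] * μ[X|m₁]) ω ∂μ := by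
    rw [← integral_condExp (h12.trans h2) (f := μ[X|m₁] * μ[X|m₂])]
    refine integral_congr_ae ?_
    filter_upwards [condExp_mul_of_stronglyMeasurable_left (m := m₁) stronglyMeasurable_condExp
      (hprod hwm hUm hw hU) integrable_condExp, condExp_condExp_of_le (f := X) (μ := μ) h12 h2]
      with ω h3 h4
    rw [h3, Pi.mul_apply, Pi.mul_apply, h4]
  have e : ∀ ω, (μ[X|m₂] ω - μ[X|m₁] ω) ^ 2
      = (μ[X|m₂] * μ[X|m₂]) ω - 2 * (μ[X|m₁] * μ[X|m₂]) ω + (μ[X|m₁] * μ[X|m₁]) ω := fun ω => by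
    simp only [Pi.mul_apply]; ring
  have e2 : ∀ Y : Ω → ℝ, ∫ ω, Y ω ^ 2 ∂μ = ∫ ω, (Y * Y) ω ∂μ := fun Y => by simp [sq]
  have hsub : Integrable (fun ω => (μ[X|m₂] * μ[X|m₂]) ω - 2 * (μ[X|m₁] * μ[X|m₂]) ω) μ :=
    (hprod hUm hUm hU hU).sub ((hprod hwm hUm hw hU).const_mul 2)
  simp_rw [e]
  rw [integral_add hsub (hprod hwm hwm hw hw),
    integral_sub (hprod hUm hUm hU hU) ((hprod hwm hUm hw hU).const_mul 2),
    integral_const_mul, hcross, e2, e2]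
  ring

variable {𝒢 : Filtration ℕ m₀}

/-- For a bounded process drifting at rate `O(1 / (n + 1))`, the successive one step revisions of
its conditional expectations are summable against `(n + 1) ^ (-q)` with `q > 1 / 2`. -/
lemma summable_integral_abs_condExp_sub {u : ℕ → Ω → ℝ} {C C' q : ℝ} (hq : 1 / 2 < q)
    (hu : ∀ n, Measurable (u n)) (hC' : 0 ≤ C') (hC : ∀ n, ∀ᵐ ω ∂μ, |u n ω| ≤ C)
    (hdrift : ∀ n, ∀ᵐ ω ∂μ, |u (n + 1) ω - u n ω| ≤ C' * invPow 1 n) :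
    Summable fun n => invPow q n * ∫ ω, |μ[u n|𝒢 (n + 1)] ω - μ[u n|𝒢 n] ω| ∂μ := by
  have hui : ∀ n, Integrable (u n) μ := fun n =>
    integrable_of_ae_abs_le (hu n).aestronglyMeasurable (hC n)
  have hb : ∀ n k, ∀ᵐ ω ∂μ, |μ[u n|𝒢 k] ω| ≤ C := fun n k =>
    ae_bdd_abs_condExp_of_ae_bdd_abs (hC n)
  have hm : ∀ n k, AEStronglyMeasurable (μ[u n|𝒢 k]) μ := fun n k =>
    integrable_condExp.aestronglyMeasurable
  have hC0 : 0 ≤ C := by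
    obtain ⟨ω, hω⟩ := (hC 0).exists
    exact (abs_nonneg _).trans hω
  set Q : ℕ → ℝ := fun n => ∫ ω, μ[u n|𝒢 n] ω ^ 2 ∂μ with hQ
  set S : ℕ → ℝ := fun n => ∫ ω, (μ[u n|𝒢 (n + 1)] ω - μ[u n|𝒢 n] ω) ^ 2 ∂μ with hS
  have hsqi : ∀ n k, Integrable (fun ω => μ[u n|𝒢 k] ω ^ 2) μ := fun n k =>
    integrable_of_ae_abs_le (C := C ^ 2) ((hm n k).pow 2) (by
      filter_upwards [hb n k] with ω h
      rw [abs_pow]; gcongr)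
  have hQC : ∀ n, Q n ≤ C ^ 2 := fun n => by
    have : Q n ≤ ∫ _, C ^ 2 ∂μ := integral_mono_ae (hsqi n n) (integrable_const _) (by
      filter_upwards [hb n n] with ω h
      exact sq_le_sq' (abs_le.1 h).1 (abs_le.1 h).2)
    simpa using this
  have hQ0 : ∀ n, 0 ≤ Q n := fun n => integral_nonneg fun ω => sq_nonneg _
  have hSQ : ∀ n, S n ≤ Q (n + 1) - Q n + 2 * C * C' * invPow 1 n := fun n => by
    have h1 : S n = ∫ ω, μ[u n|𝒢 (n + 1)] ω ^ 2 ∂μ - Q n :=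
      integral_sq_condExp_sub (𝒢.mono (Nat.le_succ n)) (𝒢.le _) (hC n)
    have h2 : ∫ ω, μ[u n|𝒢 (n + 1)] ω ^ 2 ∂μ ≤ ∫ ω, (μ[u (n + 1)|𝒢 (n + 1)] ω ^ 2
        + 2 * C * C' * invPow 1 n) ∂μ := by
      refine integral_mono_ae (hsqi _ _) ((hsqi _ _).add (integrable_const _)) ?_
      have h3 : ∀ᵐ ω ∂μ, |μ[u (n + 1) - u n|𝒢 (n + 1)] ω| ≤ C' * invPow 1 n :=
        ae_bdd_abs_condExp_of_ae_bdd_abs (hdrift n)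
      filter_upwards [hb n (n + 1), hb (n + 1) (n + 1), h3,
        condExp_sub (hui (n + 1)) (hui n) (𝒢 (n + 1))] with ω h4 h5 h6 h7
      rw [h7, Pi.sub_apply] at h6
      set y := μ[u n|𝒢 (n + 1)] ω
      set z := μ[u (n + 1)|𝒢 (n + 1)] ω
      have h8 : (y - z) * (y + z) ≤ (C' * invPow 1 n) * (2 * C) := by
        refine (le_abs_self _).trans ?_
        rw [abs_mul]
        refine mul_le_mul (by rwa [abs_sub_comm]) ?_ (abs_nonneg _) ((abs_nonneg _).trans h6)
        exact (abs_add_le _ _).trans (by linarith)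
      change y ^ 2 ≤ z ^ 2 + 2 * C * C' * invPow 1 n
      nlinarith
    rw [integral_add (hsqi _ _) (integrable_const _)] at h2
    simp only [integral_const, probReal_univ, one_smul] at h2
    rw [h1]
    linarith
  set s := q - 1 / 2 with hs
  have hs0 : 0 < s := by simp only [hs]; linarith
  have hsumS : Summable fun n => invPow s n * S n := by
    have hT := (summable_invPow (p := s + 1) (by linarith))
    refine summable_of_sum_range_le (c := C ^ 2 + 2 * C * C' * ∑' n, invPow (s + 1) n)
      (fun n => mul_nonneg (invPow_pos _ _).le (integral_nonneg fun ω => sq_nonneg _)) fun N => ?_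
    have h1 : ∀ n, invPow s n * S n ≤ (invPow s (n + 1) * (Q (n + 1) - C ^ 2)
        - invPow s n * (Q n - C ^ 2)) + 2 * C * C' * invPow (s + 1) n := fun n => by
      have h2 := mul_le_mul_of_nonneg_left (hSQ n) (invPow_pos s n).le
      have h3 := mul_le_mul_of_nonneg_right (invPow_antitone hs0.le (Nat.le_succ n))
        (sub_nonneg.2 (hQC (n + 1)))
      have h4 := invPow_mul s 1 n
      simp only [Nat.succ_eq_add_one] at h3
      rw [← h4]
      nlinarith
    refine (sum_le_sum fun n _ => h1 n).trans ?_
    rw [sum_add_distrib, sum_range_sub (fun n => invPow s n * (Q n - C ^ 2)), ← mul_sum]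
    have h5 : ∑ n ∈ range N, invPow (s + 1) n ≤ ∑' n, invPow (s + 1) n :=
      hT.sum_le_tsum _ fun n _ => (invPow_pos _ _).le
    have h6 := mul_le_mul_of_nonneg_left h5 (by positivity : 0 ≤ 2 * C * C')
    have h7 : invPow s 0 = 1 := by simp [invPow]
    have h8 := mul_nonneg (invPow_pos s N).le (sub_nonneg.2 (hQC N))
    rw [h7]
    linarith [hQ0 0]
  refine Summable.of_nonneg_of_le
    (fun n => mul_nonneg (invPow_pos _ _).le (integral_nonneg fun ω => abs_nonneg _)) (fun n => ?_)
    (hsumS.add (summable_invPow (p := q + 1 / 2) (by linarith)))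
  have hdi : Integrable (fun ω => (μ[u n|𝒢 (n + 1)] ω - μ[u n|𝒢 n] ω) ^ 2) μ :=
    integrable_of_ae_abs_le (C := (C + C) ^ 2) (((hm _ _).sub (hm _ _)).pow 2) (by
      filter_upwards [hb n n, hb n (n + 1)] with ω h1 h2
      rw [abs_pow]
      gcongr
      exact (abs_sub _ _).trans (by linarith))
  calc invPow q n * ∫ ω, |μ[u n|𝒢 (n + 1)] ω - μ[u n|𝒢 n] ω| ∂μ
      = ∫ ω, invPow q n * |μ[u n|𝒢 (n + 1)] ω - μ[u n|𝒢 n] ω| ∂μ := (integral_const_mul _ _).symm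
    _ ≤ ∫ ω, (invPow s n * (μ[u n|𝒢 (n + 1)] ω - μ[u n|𝒢 n] ω) ^ 2
          + invPow (q + 1 / 2) n) ∂μ := by
        refine integral_mono ((integrable_condExp.sub integrable_condExp).abs.const_mul _)
          ((hdi.const_mul _).add (integrable_const _)) fun ω => ?_
        set y := μ[u n|𝒢 (n + 1)] ω - μ[u n|𝒢 n] ω
        change invPow q n * |y| ≤ invPow s n * y ^ 2 + invPow (q + 1 / 2) n
        have e1 : invPow q n = invPow s n * invPow (1 / 2) n := by
          rw [invPow_mul]; congr 1; simp only [hs]; ring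
        have e2 : invPow (q + 1 / 2) n = invPow s n * (invPow (1 / 2) n * invPow (1 / 2) n) := by
          rw [invPow_mul, invPow_mul]; congr 1; simp only [hs]; ring
        have h0 := invPow_pos s n
        rw [e1, e2, ← sq_abs y]
        nlinarith [mul_nonneg h0.le (sq_nonneg (|y| - invPow (1 / 2) n)),
          mul_nonneg h0.le (mul_nonneg (abs_nonneg y) (invPow_pos (1 / 2) n).le)]
    _ = invPow s n * S n + invPow (q + 1 / 2) n := by
        rw [integral_add (hdi.const_mul _) (integrable_const _), integral_const_mul]
        simp only [integral_const, probReal_univ, one_smul, hS]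

lemma stronglyMeasurable_sqrt_max_min {m : MeasurableSpace Ω} {W : Ω → ℝ}
    (hW : StronglyMeasurable[m] W) (a c : ℝ) :
    StronglyMeasurable[m] fun ω => √(max a (min (W ω) c)) :=
  (measurable_const.max (hW.measurable.min measurable_const)).sqrt.stronglyMeasurable

lemma stronglyMeasurable_linRec {p ε : ℝ} {b : ℕ → ℝ} {r : ℕ → Ω → ℝ}
    (hr : ∀ n, StronglyMeasurable[𝒢 n] (r n)) (n : ℕ) :
    StronglyMeasurable[𝒢 n] fun ω => AdamPath.linRec p ε b (fun k => r k ω) n := by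
  induction n with
  | zero => exact stronglyMeasurable_const
  | succ n ih =>
    have hmono := 𝒢.mono (Nat.le_succ n)
    have h1 := ih.mono hmono
    have h2 := (hr n).mono hmono
    have h3 : StronglyMeasurable[𝒢 (n + 1)] fun ω => (r (n + 1) ω - b n * r n ω) / (1 - b n) :=
      ((hr (n + 1)).sub (h2.const_mul _)).div stronglyMeasurable_const
    exact ((stronglyMeasurable_const.add ((h3.pow 2).const_mul _)).mul h1).add
      stronglyMeasurable_const

/-- The hidden scaling `√(v + ε)` has an adapted bounded proxy `w`, close to it in the sense that
the conditional expectation of the scaling one step later is summably near `w`. -/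
lemma exists_adapted_scaling {p q M β ε : ℝ} {b : ℕ → ℝ} {g m v : ℕ → Ω → ℝ} (hq : 1 / 2 < q)
    (hp0 : 0 < p) (hpq : 1 - q < p) (hε : 0 < ε) (hM : 0 ≤ M) (hβ1 : β < 1)
    (hv : ∀ n, Measurable (v n))
    (hr : ∀ n, StronglyMeasurable[𝒢 n] fun ω => m n ω / √(v n ω + ε))
    (hpath : ∀ᵐ ω ∂μ, AdamPath p M β b (fun n => g n ω) (fun n => m n ω) (fun n => v n ω)) :
    ∃ w : ℕ → Ω → ℝ, (∀ n, StronglyMeasurable[𝒢 n] (w n)) ∧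
      (∀ n, ∀ᵐ ω ∂μ, √ε ≤ w n ω ∧ w n ω ≤ √(M ^ 2 + ε)) ∧
      Summable fun n =>
        invPow q n * ∫ ω, |μ[fun ω => √(v n ω + ε)|𝒢 (n + 1)] ω - w n ω| ∂μ := by
  have hs : 0 < √ε := Real.sqrt_pos.2 hε
  set u : ℕ → Ω → ℝ := fun n ω => √(v n ω + ε) with hu
  have hum : ∀ n, Measurable (u n) := fun n => ((hv n).add_const ε).sqrt
  have hub : ∀ n, ∀ᵐ ω ∂μ, √ε ≤ u n ω ∧ u n ω ≤ √(M ^ 2 + ε) := fun n => by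
    filter_upwards [hpath] with ω h using h.sqrt_mem hp0.le n
  have hua : ∀ n, ∀ᵐ ω ∂μ, |u n ω| ≤ √(M ^ 2 + ε) := fun n => by
    filter_upwards [hub n] with ω h
    rw [abs_of_nonneg (hs.le.trans h.1)]; exact h.2
  have hui : ∀ n, Integrable (u n) μ := fun n =>
    integrable_of_ae_abs_le (hum n).aestronglyMeasurable (hua n)
  rcases lt_or_ge p 1 with hp1 | hp1
  · obtain ⟨K, hK0, hK⟩ := AdamPath.exists_abs_linRec_sub_le (p := p) hp0 hp1 hε hM hβ1
    set W : ℕ → Ω → ℝ := fun n ω =>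
      AdamPath.linRec p ε b (fun k => m k ω / √(v k ω + ε)) n with hW
    set w : ℕ → Ω → ℝ := fun n ω => √(max ε (min (W n ω) (M ^ 2 + ε))) with hw
    have hwm : ∀ n, StronglyMeasurable[𝒢 n] (w n) := fun n =>
      stronglyMeasurable_sqrt_max_min
        (stronglyMeasurable_linRec (r := fun n ω => m n ω / √(v n ω + ε)) hr n) _ _
    have hwb : ∀ n ω, √ε ≤ w n ω ∧ w n ω ≤ √(M ^ 2 + ε) := fun n ω =>
      ⟨Real.sqrt_le_sqrt (le_max_left _ _), Real.sqrt_le_sqrt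
        (max_le (by nlinarith [sq_nonneg M]) (min_le_right _ _))⟩
    have hwi : ∀ n, Integrable (w n) μ := fun n =>
      integrable_of_ae_abs_le (C := √(M ^ 2 + ε)) ((hwm n).mono (𝒢.le n)).aestronglyMeasurable
        (ae_of_all _ fun ω => by rw [abs_of_nonneg (Real.sqrt_nonneg _)]; exact (hwb n ω).2)
    refine ⟨w, hwm, fun n => ae_of_all _ (hwb n), ?_⟩
    refine Summable.of_nonneg_of_le
      (fun n => mul_nonneg (invPow_pos _ _).le (integral_nonneg fun ω => abs_nonneg _))
      (fun n => ?_) ((summable_invPow (p := q + p) (by linarith)).mul_left (K / √ε))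
    have h1 : ∫ ω, |μ[u n|𝒢 (n + 1)] ω - w n ω| ∂μ ≤ ∫ ω, |(u n - w n) ω| ∂μ := by
      refine le_trans (le_of_eq (integral_congr_ae ?_))
        (integral_abs_condExp_le (m := 𝒢 (n + 1)) (u n - w n))
      filter_upwards [condExp_sub (hui n) (hwi n) (𝒢 (n + 1))] with ω h
      rw [h, Pi.sub_apply, condExp_of_stronglyMeasurable (𝒢.le _)
        ((hwm n).mono (𝒢.mono (Nat.le_succ n))) (hwi n)]
    have h2 : ∫ ω, |(u n - w n) ω| ∂μ ≤ ∫ _, K / √ε * invPow p n ∂μ := by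
      refine integral_mono_ae ((hui n).sub (hwi n)).abs (integrable_const _) ?_
      filter_upwards [hpath] with ω h
      have h3 := hK b _ _ _ h n
      have hv1 := h.v_mem hp0.le n
      have h4 : |v n ω + ε - max ε (min (W n ω) (M ^ 2 + ε))| ≤ |W n ω - (v n ω + ε)| := by
        have hx : ε ≤ v n ω + ε := by linarith [hv1.1]
        have hy : v n ω + ε ≤ M ^ 2 + ε := by linarith [hv1.2]
        generalize v n ω + ε = x at hx hy ⊢
        generalize W n ω = y
        generalize M ^ 2 + ε = z at hy ⊢
        rw [abs_le, abs_eq_max_neg]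
        constructor <;> grind
      have h5 : √(v n ω + ε) ^ 2 = v n ω + ε := Real.sq_sqrt (by linarith [hv1.1])
      have h6 : w n ω ^ 2 = max ε (min (W n ω) (M ^ 2 + ε)) :=
        Real.sq_sqrt (hε.le.trans (le_max_left _ _))
      have h7 := (h.sqrt_mem (ε := ε) hp0.le n).1
      have h8 := (hwb n ω).1
      simp only [Pi.sub_apply, hu]
      rw [div_mul_eq_mul_div, le_div_iff₀ hs]
      calc |√(v n ω + ε) - w n ω| * √ε
          ≤ |√(v n ω + ε) - w n ω| * |√(v n ω + ε) + w n ω| := by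
            gcongr
            exact le_trans (by linarith) (le_abs_self _)
        _ = |v n ω + ε - max ε (min (W n ω) (M ^ 2 + ε))| := by
            rw [← abs_mul, ← h6]; congr 1; linear_combination h5
        _ ≤ _ := h4.trans h3
    simp only [integral_const, probReal_univ, one_smul] at h2
    calc invPow q n * ∫ ω, |μ[u n|𝒢 (n + 1)] ω - w n ω| ∂μ
        ≤ invPow q n * (K / √ε * invPow p n) := by
          gcongr
          · exact (invPow_pos _ _).le
          · exact h1.trans h2
      _ = K / √ε * invPow (q + p) n := by rw [← invPow_mul]; ring
  · refine ⟨fun n => μ[u n|𝒢 n], fun n => stronglyMeasurable_condExp, fun n => ?_, ?_⟩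
    · have h1 := condExp_mono (m := 𝒢 n) (integrable_const (√ε)) (hui n)
        ((hub n).mono fun ω h => h.1)
      have h2 := condExp_mono (m := 𝒢 n) (hui n) (integrable_const (√(M ^ 2 + ε)))
        ((hub n).mono fun ω h => h.2)
      rw [condExp_const (𝒢.le n)] at h1 h2
      filter_upwards [h1, h2] with ω h3 h4 using ⟨h3, h4⟩
    · refine summable_integral_abs_condExp_sub (C' := M ^ 2 / √ε) hq hum (by positivity) hua
        fun n => ?_
      filter_upwards [hpath] with ω h
      exact (h.abs_sqrt_sub_le hp0.le hε n).trans (by gcongr; exact invPow_le_invPow hp1 n)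

/-- Lower bound for the correlation of a predictable slope `φ` with a step `y` for which the
rescaled step `u * y` is close to a multiple of a noisy version `g` of `φ`. -/
lemma le_integral_mul_of_condExp_eq {m₁ m₂ : MeasurableSpace Ω} (h12 : m₁ ≤ m₂) (h2 : m₂ ≤ m₀)
    {φ w y u g : Ω → ℝ} {c M lo hi E Y U : ℝ} (hlo : 0 < lo) (hc : 0 ≤ c)
    (hφ : StronglyMeasurable[m₁] φ) (hw : StronglyMeasurable[m₁] w)
    (hy : StronglyMeasurable[m₂] y) (hu : Measurable[m₀] u) (hg : Measurable[m₀] g)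
    (hφM : ∀ᵐ ω ∂μ, |φ ω| ≤ M) (hwb : ∀ᵐ ω ∂μ, lo ≤ w ω ∧ w ω ≤ hi)
    (hyY : ∀ᵐ ω ∂μ, |y ω| ≤ Y) (huU : ∀ᵐ ω ∂μ, |u ω| ≤ U) (hgM : ∀ᵐ ω ∂μ, |g ω| ≤ M)
    (hgφ : μ[g|m₁] =ᵐ[μ] φ) (hE : ∀ᵐ ω ∂μ, |u ω * y ω - c * g ω| ≤ E) :
    c / hi * ∫ ω, φ ω ^ 2 ∂μ - M / lo * (E + Y * ∫ ω, |μ[u|m₂] ω - w ω| ∂μ)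
      ≤ ∫ ω, φ ω * y ω ∂μ := by
  set ψ : Ω → ℝ := fun ω => φ ω / w ω with hψdef
  have hM0 : 0 ≤ M := by
    obtain ⟨ω, hω⟩ := hφM.exists
    exact (abs_nonneg _).trans hω
  have hY0 : 0 ≤ Y := by
    obtain ⟨ω, hω⟩ := hyY.exists
    exact (abs_nonneg _).trans hω
  have hψ : StronglyMeasurable[m₁] ψ := hφ.div hw
  have hψb : ∀ᵐ ω ∂μ, |ψ ω| ≤ M / lo := by
    filter_upwards [hφM, hwb] with ω h3 h4
    rw [hψdef, abs_div]
    exact div_le_div₀ hM0 h3 hlo (h4.1.trans (le_abs_self _))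
  have a1 : AEStronglyMeasurable[m₀] ψ μ := (hψ.mono (h12.trans h2)).aestronglyMeasurable
  have ay : AEStronglyMeasurable[m₀] y μ := (hy.mono h2).aestronglyMeasurable
  have aw : AEStronglyMeasurable[m₀] w μ := (hw.mono (h12.trans h2)).aestronglyMeasurable
  have aφ : AEStronglyMeasurable[m₀] φ μ := (hφ.mono (h12.trans h2)).aestronglyMeasurable
  have hprod : ∀ {Y Z : Ω → ℝ} {A B : ℝ}, AEStronglyMeasurable[m₀] Y μ →
      AEStronglyMeasurable[m₀] Z μ →
      (∀ᵐ ω ∂μ, |Y ω| ≤ A) → (∀ᵐ ω ∂μ, |Z ω| ≤ B) →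
      (∀ᵐ ω ∂μ, |(Y * Z) ω| ≤ A * B) := fun _ _ hYA hZB => by
    filter_upwards [hYA, hZB] with ω h3 h4
    rw [Pi.mul_apply, abs_mul]
    exact mul_le_mul h3 h4 (abs_nonneg _) ((abs_nonneg _).trans h3)
  have hψy := hprod a1 ay hψb hyY
  have iu : Integrable u μ := integrable_of_ae_abs_le hu.aestronglyMeasurable huU
  have ig : Integrable g μ := integrable_of_ae_abs_le hg.aestronglyMeasurable hgM
  have iU : Integrable (μ[u|m₂]) μ := integrable_condExp
  have hUb : ∀ᵐ ω ∂μ, |μ[u|m₂] ω| ≤ U := ae_bdd_abs_condExp_of_ae_bdd_abs huU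
  have iw : Integrable w μ := integrable_of_ae_abs_le (C := hi) aw (by
    filter_upwards [hwb] with ω h
    rw [abs_of_nonneg (hlo.le.trans h.1)]; exact h.2)
  have iψyu : Integrable (ψ * y * u) μ :=
    integrable_of_ae_abs_le ((a1.mul ay).mul hu.aestronglyMeasurable)
      (hprod (a1.mul ay) hu.aestronglyMeasurable hψy huU)
  have iψyU : Integrable (ψ * y * μ[u|m₂]) μ :=
    integrable_of_ae_abs_le ((a1.mul ay).mul iU.aestronglyMeasurable)
      (hprod (a1.mul ay) iU.aestronglyMeasurable hψy hUb)
  have iψg : Integrable (ψ * g) μ :=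
    integrable_of_ae_abs_le (a1.mul hg.aestronglyMeasurable)
      (hprod a1 hg.aestronglyMeasurable hψb hgM)
  have iφ2 : Integrable (fun ω => φ ω ^ 2) μ :=
    integrable_of_ae_abs_le (C := M ^ 2) (aφ.pow 2) (by
      filter_upwards [hφM] with ω h
      rw [abs_pow]; gcongr)
  have iψφ : Integrable (ψ * φ) μ :=
    integrable_of_ae_abs_le (a1.mul aφ) (hprod a1 aφ hψb hφM)
  have iφy : Integrable (fun ω => φ ω * y ω) μ :=
    integrable_of_ae_abs_le (aφ.mul ay) (hprod aφ ay hφM hyY)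
  have s1 : ∫ ω, (ψ * y * μ[u|m₂]) ω ∂μ = ∫ ω, (ψ * y * u) ω ∂μ := by
    rw [← integral_condExp h2 (f := ψ * y * u)]
    exact integral_congr_ae (condExp_mul_of_stronglyMeasurable_left
      ((hψ.mono h12).mul hy) iψyu iu).symm
  have s2 : ∫ ω, (ψ * g) ω ∂μ = ∫ ω, (ψ * φ) ω ∂μ := by
    rw [← integral_condExp (h12.trans h2) (f := ψ * g)]
    refine integral_congr_ae ((condExp_mul_of_stronglyMeasurable_left hψ iψg ig).trans ?_)
    filter_upwards [hgφ] with ω h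
    rw [Pi.mul_apply, Pi.mul_apply, h]
  have iUw : Integrable (fun ω => M / lo * Y * |μ[u|m₂] ω - w ω|) μ :=
    (iU.sub iw).abs.const_mul _
  have t1 : ∫ ω, (ψ * y * μ[u|m₂]) ω ∂μ - M / lo * Y * ∫ ω, |μ[u|m₂] ω - w ω| ∂μ
      ≤ ∫ ω, φ ω * y ω ∂μ := by
    rw [← integral_const_mul, ← integral_sub iψyU iUw]
    refine integral_mono_ae (iψyU.sub iUw) iφy ?_
    filter_upwards [hψy, hwb] with ω h3 h4
    have e : φ ω = ψ ω * w ω := (div_mul_cancel₀ _ (hlo.trans_le h4.1).ne').symm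
    have h5 : (ψ * y) ω * (μ[u|m₂] ω - w ω) ≤ M / lo * Y * |μ[u|m₂] ω - w ω| := by
      refine (le_abs_self _).trans ?_
      rw [abs_mul]
      gcongr
    simp only [Pi.mul_apply] at h5 ⊢
    rw [e]
    linarith
  have t2 : c * ∫ ω, (ψ * g) ω ∂μ - M / lo * E ≤ ∫ ω, (ψ * y * u) ω ∂μ := by
    have : ∫ ω, (c * (ψ * g) ω - M / lo * E) ∂μ ≤ ∫ ω, (ψ * y * u) ω ∂μ := by
      refine integral_mono_ae ((iψg.const_mul c).sub (integrable_const _)) iψyu ?_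
      filter_upwards [hψb, hE] with ω h3 h4
      have h5 : |ψ ω * (u ω * y ω - c * g ω)| ≤ M / lo * E := by
        rw [abs_mul]
        exact mul_le_mul h3 h4 (abs_nonneg _) ((abs_nonneg _).trans h3)
      have := (abs_le.1 h5).1
      simp only [Pi.mul_apply]
      linarith
    rw [integral_sub (iψg.const_mul c) (integrable_const _), integral_const_mul] at this
    simpa using this
  have t3 : 1 / hi * ∫ ω, φ ω ^ 2 ∂μ ≤ ∫ ω, (ψ * φ) ω ∂μ := by
    rw [← integral_const_mul]
    refine integral_mono_ae (iφ2.const_mul _) iψφ ?_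
    filter_upwards [hwb] with ω h4
    have h5 : 0 < w ω := hlo.trans_le h4.1
    have e : (ψ * φ) ω = 1 / w ω * φ ω ^ 2 := by
      simp only [Pi.mul_apply, hψdef]; ring
    rw [e]
    have := one_div_le_one_div_of_le h5 h4.2
    gcongr
  have t4 := mul_le_mul_of_nonneg_left t3 hc
  rw [← s2] at t4
  rw [s1] at t1
  have e1 : c / hi * ∫ ω, φ ω ^ 2 ∂μ = c * (1 / hi * ∫ ω, φ ω ^ 2 ∂μ) := by ring
  rw [e1]
  linarith

end Conditional

/-- Nonnegative functions with summable integrals are almost everywhere summable. -/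
lemma ae_summable_of_summable_integral {Ω : Type*} {m₀ : MeasurableSpace Ω} {μ : Measure Ω}
    {F : ℕ → Ω → ℝ} (hF : ∀ n, Integrable (F n) μ)
    (h0 : ∀ n ω, 0 ≤ F n ω) (hs : Summable fun n => ∫ ω, F n ω ∂μ) :
    ∀ᵐ ω ∂μ, Summable fun n => F n ω := by
  have h1 : ∫⁻ ω, ∑' n, ENNReal.ofReal (F n ω) ∂μ ≠ ⊤ := by
    rw [lintegral_tsum fun n => (hF n).aemeasurable.ennreal_ofReal]
    have : ∀ n, ∫⁻ ω, ENNReal.ofReal (F n ω) ∂μ = ENNReal.ofReal (∫ ω, F n ω ∂μ) := fun n =>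
      (ofReal_integral_eq_lintegral_ofReal (hF n) (ae_of_all _ (h0 n))).symm
    simp_rw [this]
    exact hs.tsum_ofReal_ne_top
  filter_upwards [ae_lt_top' (AEMeasurable.tsum fun n => (hF n).aemeasurable.ennreal_ofReal) h1]
    with ω h
  have := ENNReal.summable_toReal h.ne
  simpa [ENNReal.toReal_ofReal, h0] using this

section Descent

variable {E : Type*} [NormedAddCommGroup E] [InnerProductSpace ℝ E] [CompleteSpace E]
  {f : E → ℝ} {L : ℝ}

lemma le_add_inner_gradient_add (hf : Differentiable ℝ f) (hL : 0 ≤ L)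
    (hLip : ∀ y z, ‖gradient f y - gradient f z‖ ≤ L * ‖y - z‖) (x y : E) :
    f y ≤ f x + inner ℝ (gradient f x) (y - x) + L * ‖y - x‖ ^ 2 := by
  have h := (convex_segment x y).norm_image_sub_le_of_norm_fderiv_le' (𝕜 := ℝ) (f := f)
    (φ := fderiv ℝ f x) (C := L * ‖y - x‖) (fun z _ => hf z) (fun z hz => by
      rw [← toDual_gradient, ← toDual_gradient, ← map_sub, LinearIsometryEquiv.norm_map]
      refine (hLip z x).trans ?_
      gcongr
      exact norm_sub_le_of_mem_segment hz) (left_mem_segment ℝ x y) (right_mem_segment ℝ x y)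
  rw [← inner_gradient_left] at h
  have := (abs_le.1 h).2
  linarith

/-- A path `X` moving from `X n` to `X (n + 1)` along `-ρ (n + 1)` with step size `η n`. -/
structure DescentPath (η : ℕ → ℝ) (D : ℝ) (X ρ : ℕ → E) : Prop where
  succ : ∀ n, X (n + 1) = X n - η n • ρ (n + 1)
  sq_norm_le : ∀ n, ‖ρ n‖ ^ 2 ≤ D

variable {η : ℕ → ℝ} {D : ℝ} {X ρ : ℕ → E}

lemma DescentPath.sum_mul_inner_le (h : DescentPath η D X ρ) (hf : Differentiable ℝ f) (hL : 0 ≤ L)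
    (hLip : ∀ y z, ‖gradient f y - gradient f z‖ ≤ L * ‖y - z‖) {fstar : ℝ}
    (hflb : ∀ y, fstar ≤ f y) (hη : Summable fun n => η n ^ 2) (N : ℕ) :
    ∑ n ∈ range N, η n * inner ℝ (gradient f (X n)) (ρ (n + 1))
      ≤ f (X 0) - fstar + L * D * ∑' n, η n ^ 2 := by
  have hD : 0 ≤ D := (sq_nonneg _).trans (h.sq_norm_le 0)
  have h1 : ∀ n, η n * inner ℝ (gradient f (X n)) (ρ (n + 1))
      ≤ f (X n) - f (X (n + 1)) + L * D * η n ^ 2 := fun n => by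
    have h2 := le_add_inner_gradient_add hf hL hLip (X n) (X (n + 1))
    have h3 : X (n + 1) - X n = -(η n • ρ (n + 1)) := by rw [h.succ]; abel
    rw [h3, inner_neg_right, inner_smul_right, norm_neg, norm_smul, mul_pow, Real.norm_eq_abs,
      sq_abs] at h2
    have h4 := mul_le_mul_of_nonneg_left (h.sq_norm_le (n + 1)) (mul_nonneg hL (sq_nonneg (η n)))
    nlinarith
  refine (sum_le_sum fun n _ => h1 n).trans ?_
  rw [sum_add_distrib, sum_range_sub' fun n => f (X n), ← mul_sum]
  have h5 := mul_le_mul_of_nonneg_left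
    (hη.sum_le_tsum (range N) fun n _ => sq_nonneg (η n)) (mul_nonneg hL hD)
  linarith [hflb (X N)]

lemma DescentPath.inner_sub_le (h : DescentPath η D X ρ) (hL : 0 ≤ L) (hη : ∀ n, 0 ≤ η n)
    (hLip : ∀ y z, ‖gradient f y - gradient f z‖ ≤ L * ‖y - z‖) (n : ℕ) :
    inner ℝ (gradient f (X n)) (ρ (n + 1)) - L * D * η n
      ≤ inner ℝ (gradient f (X (n + 1))) (ρ (n + 1)) := by
  have h1 := real_inner_le_norm (gradient f (X n) - gradient f (X (n + 1))) (ρ (n + 1))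
  have h2 := hLip (X n) (X (n + 1))
  rw [h.succ, sub_sub_cancel, norm_smul, Real.norm_of_nonneg (hη n), ← h.succ] at h2
  have h3 := mul_le_mul_of_nonneg_right h2 (norm_nonneg (ρ (n + 1)))
  have h4 := mul_le_mul_of_nonneg_left (h.sq_norm_le (n + 1)) (mul_nonneg hL (hη n))
  rw [inner_sub_left] at h1
  nlinarith

end Descent

/-- The update direction `m / √(v + ε)` of Adam. -/
def adamStep {d : ℕ} (ε : ℝ) (m v : EuclideanSpace ℝ (Fin d)) : EuclideanSpace ℝ (Fin d) :=
  WithLp.toLp 2 fun i => m i / √(v i + ε)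

/-- Along the Adam iterates `X` the squared gradients are almost surely summable against the step
sizes. -/
lemma ae_summable_sq_norm_gradient {Ω : Type*} {m₀ : MeasurableSpace Ω} {μ : Measure Ω}
    [IsProbabilityMeasure μ] {d : ℕ} {f : EuclideanSpace ℝ (Fin d) → ℝ} {ε β M L fstar q p : ℝ}
    {b : ℕ → ℝ} {X g m v : ℕ → Ω → EuclideanSpace ℝ (Fin d)} {𝒢 : Filtration ℕ m₀}
    (hε : 0 < ε) (hβ0 : 0 ≤ β) (hβ1 : β < 1) (hb : ∀ n, 0 ≤ b n ∧ b n ≤ β)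
    (hq : 1 / 2 < q) (hp0 : 0 < p) (hpq : 1 - q < p)
    (hf : Differentiable ℝ f) (hL : 0 ≤ L)
    (hLip : ∀ y z, ‖gradient f y - gradient f z‖ ≤ L * ‖y - z‖) (hflb : ∀ y, fstar ≤ f y)
    (hX : ∀ n, StronglyMeasurable[𝒢 n] (X n)) {X₀ : EuclideanSpace ℝ (Fin d)}
    (hX0 : ∀ ω, X 0 ω = X₀)
    (hXsucc : ∀ n ω, X (n + 1) ω = X n ω - invPow q n • adamStep ε (m (n + 1) ω) (v (n + 1) ω))
    (hg : ∀ n, Measurable (g n)) (hv : ∀ n i, Measurable fun ω => v n ω i)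
    (hpath : ∀ i, ∀ᵐ ω ∂μ,
      AdamPath p M β b (fun n => g n ω i) (fun n => m n ω i) (fun n => v n ω i))
    (hm0 : ∀ ω, m 0 ω = 0)
    (hunb : ∀ n, μ[g n|𝒢 n] =ᵐ[μ] fun ω => gradient f (X n ω)) (hM : 0 ≤ M)
    (hgM : ∀ n, ∀ᵐ ω ∂μ, ‖g n ω‖ ≤ M) :
    ∀ᵐ ω ∂μ, Summable fun n => invPow q n * ‖gradient f (X n ω)‖ ^ 2 := by
  have hs : 0 < √ε := Real.sqrt_pos.2 hε
  have hη0 : ∀ n, 0 < invPow q n := invPow_pos q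
  set R := M / √ε with hR
  have hR0 : 0 ≤ R := div_nonneg hM hs.le
  set ρ : ℕ → Ω → EuclideanSpace ℝ (Fin d) := fun n ω => adamStep ε (m n ω) (v n ω) with hρ
  set φ : ℕ → Ω → EuclideanSpace ℝ (Fin d) := fun n ω => gradient f (X n ω) with hφ
  have hρm : ∀ n, StronglyMeasurable[𝒢 n] (ρ n) := fun n => by
    cases n with
    | zero =>
      have : ρ 0 = fun _ => 0 := by
        ext ω i
        simp [hρ, adamStep, hm0]
      rw [this]
      exact stronglyMeasurable_const
    | succ n =>
      have : ρ (n + 1) = fun ω => (invPow q n)⁻¹ • (X n ω - X (n + 1) ω) := by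
        ext1 ω
        rw [hXsucc, sub_sub_cancel, inv_smul_smul₀ (hη0 n).ne']
      rw [this]
      exact (((hX n).mono (𝒢.mono (Nat.le_succ n))).sub (hX (n + 1))).const_smul (invPow q n)⁻¹
  have hproj : ∀ i, Continuous fun y : EuclideanSpace ℝ (Fin d) => y i := fun i => by fun_prop
  have hρi : ∀ n i, StronglyMeasurable[𝒢 n] fun ω => ρ n ω i := fun n i =>
    (hproj i).comp_stronglyMeasurable (hρm n)
  have hgrad : Continuous (gradient f) :=
    (LipschitzWith.of_dist_le_mul (K := ⟨L, hL⟩) fun y z => by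
      rw [dist_eq_norm, dist_eq_norm]; exact hLip y z).continuous
  have hφi : ∀ n i, StronglyMeasurable[𝒢 n] fun ω => φ n ω i := fun n i =>
    ((hproj i).comp hgrad).comp_stronglyMeasurable (hX n)
  have hgi : ∀ n i, Measurable fun ω => g n ω i := fun n i => (hproj i).measurable.comp (hg n)
  have hgiM : ∀ n i, ∀ᵐ ω ∂μ, |g n ω i| ≤ M := fun n i => by
    filter_upwards [hpath i] with ω h using h.abs_g_le n
  have hunbi : ∀ n i, μ[fun ω => g n ω i|𝒢 n] =ᵐ[μ] fun ω => φ n ω i := fun n i => by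
    have hint : Integrable (g n) μ := Integrable.of_bound (hg n).aestronglyMeasurable M (hgM n)
    have h1 := ContinuousLinearMap.comp_condExp_comm (m := 𝒢 n) hint
      (EuclideanSpace.proj i : EuclideanSpace ℝ (Fin d) →L[ℝ] ℝ)
    filter_upwards [h1, hunb n] with ω h2 h3
    have h4 : μ[fun ω => g n ω i|𝒢 n] ω = μ[g n|𝒢 n] ω i := h2.symm
    rw [h4, h3]
  have hφM : ∀ n i, ∀ᵐ ω ∂μ, |φ n ω i| ≤ M := fun n i => by
    filter_upwards [hunbi n i, ae_bdd_abs_condExp_of_ae_bdd_abs (m := 𝒢 n) (hgiM n i)]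
      with ω h1 h2
    rwa [h1] at h2
  have hρR : ∀ n i, ∀ᵐ ω ∂μ, |ρ n ω i| ≤ R := fun n i => by
    filter_upwards [hpath i] with ω h using h.abs_ratio_le hp0.le hε hβ1 n
  have hdesc : ∀ᵐ ω ∂μ, DescentPath (invPow q) (d * R ^ 2) (fun n => X n ω) fun n => ρ n ω := by
    filter_upwards [ae_all_iff.2 hpath] with ω h
    refine ⟨fun n => hXsucc n ω, fun n => ?_⟩
    rw [EuclideanSpace.real_norm_sq_eq]
    calc ∑ i, ρ n ω i ^ 2 ≤ ∑ _ : Fin d, R ^ 2 := sum_le_sum fun i _ => by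
          rw [← sq_abs]
          have := (h i).abs_ratio_le hp0.le hε hβ1 n
          gcongr
          exact this
      _ = d * R ^ 2 := by simp
  have aφ : ∀ n i, AEStronglyMeasurable (fun ω => φ n ω i) μ := fun n i =>
    ((hφi n i).mono (𝒢.le n)).aestronglyMeasurable
  have aρ : ∀ n i, AEStronglyMeasurable (fun ω => ρ n ω i) μ := fun n i =>
    ((hρi n i).mono (𝒢.le n)).aestronglyMeasurable
  have iφρ : ∀ n k i, Integrable (fun ω => φ n ω i * ρ k ω i) μ := fun n k i =>
    integrable_of_ae_abs_le (C := M * R) ((aφ n i).mul (aρ k i)) (by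
      filter_upwards [hφM n i, hρR k i] with ω h1 h2
      rw [abs_mul]
      gcongr)
  have iφφ : ∀ n i, Integrable (fun ω => φ n ω i ^ 2) μ := fun n i =>
    integrable_of_ae_abs_le (C := M ^ 2) ((aφ n i).pow 2) (by
      filter_upwards [hφM n i] with ω h1
      rw [abs_pow]
      gcongr)
  have hinner : ∀ n k ω, inner ℝ (φ n ω) (ρ k ω) = ∑ i, φ n ω i * ρ k ω i := fun n k ω => by
    simp [PiLp.inner_apply, mul_comm]
  have iinner : ∀ n k, Integrable (fun ω => inner ℝ (φ n ω) (ρ k ω)) μ := fun n k => by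
    simp_rw [hinner]
    exact integrable_finsetSum _ fun i _ => iφρ n k i
  have inorm : ∀ n, Integrable (fun ω => ‖φ n ω‖ ^ 2) μ := fun n => by
    simp_rw [EuclideanSpace.real_norm_sq_eq]
    exact integrable_finsetSum _ fun i _ => iφφ n i
  choose w hwm hwb hwsum using fun i : Fin d =>
    exists_adapted_scaling (𝒢 := 𝒢) (μ := μ) (ε := ε) (g := fun n ω => g n ω i)
      (m := fun n ω => m n ω i) (v := fun n ω => v n ω i) hq hp0 hpq hε hM hβ1
      (fun n => hv n i) (fun n => hρi n i) (hpath i)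
  set δ : Fin d → ℕ → ℝ := fun i n =>
    ∫ ω, |μ[fun ω => √(v n ω i + ε)|𝒢 (n + 1)] ω - w i n ω| ∂μ with hδ
  have hδ0 : ∀ i n, 0 ≤ δ i n := fun i n => integral_nonneg fun ω => abs_nonneg _
  set hi := √(M ^ 2 + ε) with hhi
  have hhi0 : 0 < hi := Real.sqrt_pos.2 (by positivity)
  set c := (1 - β) / hi with hc
  have hc0 : 0 < c := div_pos (by linarith) hhi0
  have hcoord : ∀ n i, b n * ∫ ω, φ n ω i * ρ n ω i ∂μ + c * ∫ ω, φ n ω i ^ 2 ∂μ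
      - M / √ε * (R * (M ^ 2 / √ε) * invPow p n + 2 * R * δ i n)
      ≤ ∫ ω, φ n ω i * ρ (n + 1) ω i ∂μ := fun n i => by
    have h1 := le_integral_mul_of_condExp_eq (μ := μ) (𝒢.mono (Nat.le_succ n)) (𝒢.le (n + 1))
      (φ := fun ω => φ n ω i) (w := w i n) (y := fun ω => ρ (n + 1) ω i - b n * ρ n ω i)
      (u := fun ω => √(v n ω i + ε)) (g := fun ω => g n ω i) (c := 1 - b n) (M := M) (lo := √ε)
      (hi := hi) (E := R * (M ^ 2 / √ε) * invPow p n) (Y := 2 * R) (U := hi) hs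
      (by linarith [(hb n).2]) (hφi n i) (hwm i n)
      ((hρi (n + 1) i).sub (((hρi n i).mono (𝒢.mono (Nat.le_succ n))).const_mul _))
      ((hv n i).add_const ε).sqrt (hgi n i) (hφM n i) (hwb i n)
      (by
        filter_upwards [hρR n i, hρR (n + 1) i] with ω h1 h2
        refine (abs_sub _ _).trans ?_
        rw [abs_mul, abs_of_nonneg (hb n).1]
        have : b n * |ρ n ω i| ≤ 1 * R :=
          mul_le_mul (by linarith [(hb n).2]) h1 (abs_nonneg _) zero_le_one
        linarith)
      (by
        filter_upwards [hpath i] with ω h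
        rw [abs_of_nonneg (Real.sqrt_nonneg _)]
        exact (h.sqrt_mem hp0.le n).2)
      (hgiM n i) (hunbi n i)
      (by
        filter_upwards [hpath i] with ω h using h.abs_sqrt_mul_sub_le hp0.le hε hβ1 n)
    have h2 : ∫ ω, φ n ω i * (ρ (n + 1) ω i - b n * ρ n ω i) ∂μ
        = ∫ ω, φ n ω i * ρ (n + 1) ω i ∂μ - b n * ∫ ω, φ n ω i * ρ n ω i ∂μ := by
      rw [← integral_const_mul, ← integral_sub (iφρ n (n + 1) i) ((iφρ n n i).const_mul _)]
      congr 1 with ω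
      ring
    have h3 : c * ∫ ω, φ n ω i ^ 2 ∂μ ≤ (1 - b n) / hi * ∫ ω, φ n ω i ^ 2 ∂μ := by
      have : 0 ≤ ∫ ω, φ n ω i ^ 2 ∂μ := integral_nonneg fun ω => sq_nonneg _
      rw [hc]
      gcongr
      exact (hb n).2
    rw [h2] at h1
    linarith
  set A : ℕ → ℝ := fun n => ∫ ω, inner ℝ (φ n ω) (ρ (n + 1) ω) ∂μ with hA
  set B : ℕ → ℝ := fun n => ∫ ω, ‖φ n ω‖ ^ 2 ∂μ with hB
  have hsucc : ∀ n, b n * ∫ ω, inner ℝ (φ n ω) (ρ n ω) ∂μ + c * B n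
      - ∑ i, M / √ε * (R * (M ^ 2 / √ε) * invPow p n + 2 * R * δ i n) ≤ A n := fun n => by
    simp only [hA, hB, hinner, EuclideanSpace.real_norm_sq_eq]
    rw [integral_finsetSum _ fun i _ => iφρ n n i, integral_finsetSum _ fun i _ => iφφ n i,
      integral_finsetSum _ fun i _ => iφρ n (n + 1) i, mul_sum, mul_sum, ← sum_add_distrib,
      ← sum_sub_distrib]
    exact sum_le_sum fun i _ => hcoord n i
  have hshift : ∀ n, A n - L * (d * R ^ 2) * invPow q n
      ≤ ∫ ω, inner ℝ (φ (n + 1) ω) (ρ (n + 1) ω) ∂μ := fun n => by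
    have h1 : ∫ ω, (inner ℝ (φ n ω) (ρ (n + 1) ω) - L * (d * R ^ 2) * invPow q n) ∂μ
        ≤ ∫ ω, inner ℝ (φ (n + 1) ω) (ρ (n + 1) ω) ∂μ := by
      refine integral_mono_ae ((iinner _ _).sub (integrable_const _)) (iinner _ _) ?_
      filter_upwards [hdesc] with ω h
      exact h.inner_sub_le hL (fun n => (hη0 n).le) hLip n
    rw [integral_sub (iinner _ _) (integrable_const _)] at h1
    simpa using h1
  have hη2 : Summable fun n => invPow q n ^ 2 := by
    simp_rw [sq, invPow_mul]
    exact summable_invPow (by linarith)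
  have hsum : ∀ N, ∑ n ∈ range N, invPow q n * A n
      ≤ f X₀ - fstar + L * (d * R ^ 2) * ∑' n, invPow q n ^ 2 := fun N => by
    have h1 : ∫ ω, ∑ n ∈ range N, invPow q n * inner ℝ (φ n ω) (ρ (n + 1) ω) ∂μ
        ≤ ∫ _, (f X₀ - fstar + L * (d * R ^ 2) * ∑' n, invPow q n ^ 2) ∂μ := by
      refine integral_mono_ae (integrable_finsetSum _ fun n _ => (iinner _ _).const_mul _)
        (integrable_const _) ?_
      filter_upwards [hdesc] with ω h
      simpa only [hX0] using h.sum_mul_inner_le hf hL hLip hflb hη2 N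
    rw [integral_finsetSum _ fun n _ => (iinner _ _).const_mul _] at h1
    simpa only [integral_const_mul, integral_const, probReal_univ, one_smul] using h1
  set e : ℕ → ℝ := fun n =>
    ∑ i, M / √ε * (R * (M ^ 2 / √ε) * invPow p (n + 1) + 2 * R * δ i (n + 1))
      + β * (L * (d * R ^ 2) * invPow q n) with he
  have he0 : ∀ n, 0 ≤ e n := fun n => by
    have h1 := (hη0 n).le
    have h2 := (invPow_pos p (n + 1)).le
    refine add_nonneg (sum_nonneg fun i _ => ?_) (by positivity)
    have := hδ0 i (n + 1)
    positivity
  have hηe : Summable fun n => invPow q (n + 1) * e n := by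
    have h1 : Summable fun n => ∑ i, M / √ε * (R * (M ^ 2 / √ε) * invPow (q + p) (n + 1)
        + 2 * R * (invPow q (n + 1) * δ i (n + 1))) :=
      summable_sum fun i _ => (((((summable_nat_add_iff 1).2
        (summable_invPow (p := q + p) (by linarith))).mul_left _).add
          (((summable_nat_add_iff 1).2 (hwsum i)).mul_left (2 * R))).mul_left _)
    refine Summable.of_nonneg_of_le (fun n => mul_nonneg (hη0 _).le (he0 n)) (fun n => ?_)
      (h1.add (hη2.mul_left (β * (L * (d * R ^ 2)))))
    have h2 := mul_le_mul_of_nonneg_right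
      (invPow_antitone (by linarith : 0 ≤ q) (Nat.le_succ n)) (hη0 n).le
    have h3 := mul_le_mul_of_nonneg_left h2 (by positivity : 0 ≤ β * (L * (d * R ^ 2)))
    simp only [he, mul_add, mul_sum, sum_add_distrib, ← invPow_mul]
    simp only [Nat.succ_eq_add_one] at h3
    refine add_le_add (add_le_add (le_of_eq ?_) (le_of_eq ?_)) (by nlinarith)
    all_goals exact sum_congr rfl fun i _ => by ring
  refine ae_summable_of_summable_integral (fun n => (inorm n).const_mul _)
    (fun n ω => mul_nonneg (hη0 n).le (sq_nonneg _)) ?_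
  simp_rw [integral_const_mul]
  refine summable_of_momentum_descent (A := A) (b := fun n => b (n + 1)) (e := e) (c := c) hβ0 hβ1
    hc0 hη0 (invPow_antitone (by linarith)) (fun n => integral_nonneg fun ω => sq_nonneg _) he0
    (fun n => hb (n + 1)) (fun n => ?_) hηe hsum
  have h1 := mul_le_mul_of_nonneg_left (hshift n) (hb (n + 1)).1
  have h2 : b (n + 1) * (L * (d * R ^ 2) * invPow q n) ≤ β * (L * (d * R ^ 2) * invPow q n) := by
    have := (hη0 n).le
    gcongr
    exact (hb (n + 1)).2
  have h3 := hsucc (n + 1)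
  simp only [he]
  linarith

theorem adam_almost_sure_rate_concrete
    {Ω : Type*} [MeasurableSpace Ω] {μ : MeasureTheory.Measure Ω}
    [MeasureTheory.IsProbabilityMeasure μ]
    (d : ℕ) (hd : 1 ≤ d)
    (f : EuclideanSpace ℝ (Fin d) → ℝ)
    (ε β : ℝ) (hε : 0 < ε) (hβ0 : 0 ≤ β) (hβ1 : β < 1)
    (βs θs η : ℕ → ℝ)
    (hβs : ∀ k, 1 ≤ k → 0 ≤ βs k ∧ βs k ≤ β)
    (g m v x : ℕ → Ω → EuclideanSpace ℝ (Fin d))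
    (hgmeas : ∀ k, Measurable (g k))
    (hxmeas : ∀ k, Measurable (x k))
    (x1 : EuclideanSpace ℝ (Fin d))
    (hm0 : ∀ ω, m 0 ω = 0) (hv0 : ∀ ω, v 0 ω = 0) (hx1 : ∀ ω, x 1 ω = x1)
    (hmrec : ∀ k, 1 ≤ k → ∀ ω, m k ω = βs k • m (k - 1) ω + (1 - βs k) • g k ω)
    (hvrec : ∀ k, 1 ≤ k → ∀ ω, ∀ i,
      v k ω i = θs k * v (k - 1) ω i + (1 - θs k) * (g k ω i) ^ 2)
    (hxrec : ∀ k, 1 ≤ k → ∀ ω, ∀ i,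
      x (k + 1) ω i = x k ω i - η k * (m k ω i / Real.sqrt (v k ω i + ε)))
    (M : ℝ) (hM : 0 < M)
    (hunbiased : ∀ k, 1 ≤ k →
      μ[g k | ⨆ i ∈ Finset.Icc 1 k, MeasurableSpace.comap (x i) inferInstance]
        =ᵐ[μ] fun ω => gradient f (x k ω))
    (hgbd : ∀ k, 1 ≤ k → ∀ᵐ ω ∂μ, ‖g k ω‖ ≤ M)
    (fstar L : ℝ)
    (hflb : ∀ y, fstar ≤ f y)
    (hfdiff : Differentiable ℝ f)
    (hL : 0 < L)
    (hsmooth : ∀ y z, ‖gradient f y - gradient f z‖ ≤ L * ‖y - z‖)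
    (q p : ℝ) (hq : 1 / 2 < q) (hq1 : q < 1) (hp : 1 - q < p)
    (hηdef : ∀ k : ℕ, 1 ≤ k → η k = 1 / (k : ℝ) ^ q)
    (hθdef : ∀ k : ℕ, 1 ≤ k → θs k = 1 - 1 / (k : ℝ) ^ p) :
    ∀ᵐ ω ∂μ, Tendsto
      (fun K : ℕ => ((K + 1 : ℕ) : ℝ) ^ (1 - q) *
        (Finset.Icc 1 (K + 1)).inf' (Finset.nonempty_Icc.mpr (by omega))
          (fun k => ‖gradient f (x k ω)‖ ^ 2))
      atTop (nhds 0) := by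
  have hp0 : 0 < p := by linarith
  set 𝒢 : Filtration ℕ ‹MeasurableSpace Ω› :=
    { seq := fun n => ⨆ i ∈ Finset.Icc 1 (n + 1), MeasurableSpace.comap (x i) inferInstance
      mono' := fun a c hac => biSup_mono fun i hi =>
        Finset.Icc_subset_Icc_right (Nat.add_le_add_right hac 1) hi
      le' := fun n => iSup₂_le fun i _ => (hxmeas i).comap_le }
  have hη : ∀ n, η (n + 1) = invPow q n := fun n => by
    rw [hηdef _ n.succ_pos, one_div_rpow_eq_invPow]
  have hθ : ∀ n, θs (n + 1) = 1 - invPow p n := fun n => by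
    rw [hθdef _ n.succ_pos, one_div_rpow_eq_invPow]
  have hmsucc : ∀ n ω, m (n + 1) ω = βs (n + 1) • m n ω + (1 - βs (n + 1)) • g (n + 1) ω :=
    fun n ω => hmrec _ n.succ_pos ω
  have hvsucc : ∀ n ω i, v (n + 1) ω i
      = (1 - invPow p n) * v n ω i + invPow p n * g (n + 1) ω i ^ 2 := fun n ω i => by
    have := hvrec _ n.succ_pos ω i
    rw [hθ, sub_sub_cancel] at this
    exact this
  have hvmeas : ∀ n i, Measurable fun ω => v n ω i := fun n i => by
    induction n with
    | zero => simp [hv0]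
    | succ n ih =>
      have hgi : Measurable fun ω => g (n + 1) ω i :=
        (by fun_prop : Continuous fun y : EuclideanSpace ℝ (Fin d) => y i).measurable.comp
          (hgmeas (n + 1))
      simp_rw [hvsucc]
      exact (ih.const_mul _).add ((hgi.pow_const 2).const_mul _)
  have hsum := ae_summable_sq_norm_gradient (𝒢 := 𝒢) (β := β) (b := fun n => βs (n + 1))
    (X := fun n => x (n + 1)) (g := fun n => g (n + 1)) (m := m) (v := v) (X₀ := x1) hε hβ0 hβ1
    (fun n => hβs _ n.succ_pos) hq hp0 hp hfdiff hL.le hsmooth hflb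
    (fun n => Measurable.stronglyMeasurable <| (comap_measurable (x (n + 1))).mono
      (le_iSup₂_of_le (n + 1) (Finset.mem_Icc.2 ⟨n.succ_pos, le_rfl⟩) le_rfl) le_rfl)
    hx1
    (fun n ω => by
      ext i
      simpa [adamStep, hη] using hxrec _ n.succ_pos ω i)
    (fun n => hgmeas _) hvmeas
    (fun i => by
      filter_upwards [ae_all_iff.2 fun n : ℕ => hgbd (n + 1) n.succ_pos] with ω h
      exact
        { m_zero := by simp [hm0]
          v_zero := by simp [hv0]
          m_succ := fun n => by simp [hmsucc]
          v_succ := fun n => hvsucc n ω i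
          b_mem := fun n => hβs _ n.succ_pos
          abs_g_le := fun n => (PiLp.norm_apply_le (g (n + 1) ω) i).trans (h n) })
    hm0 (fun n => hunbiased _ n.succ_pos) hM.le (fun n => hgbd _ n.succ_pos)
  filter_upwards [hsum] with ω h
  exact tendsto_rpow_mul_inf'_of_summable (by linarith) (fun k => sq_nonneg _) h
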